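/- arXiv:2205.05363 — 3 statements merged into one kernel-verified Lean document; each statement's English description precedes it below -/
import Mathlib

section
/- For every instance with three agents having additive nonnegative valuations over a finite set of items, and for every labeling of the three agents as U, C and R, there exists an allocation A = (A_U, A_C, A_R) in which agent U receives at least her full proportional share, v^U(A_U) ≥ PS^U, agent C receives at least her full maximin share, v^C(A_C) ≥ MMS^C, and agent R receives v^R(A_R) ≥ (9/10)·MMS^R. (That is, a (9/10)-P⁺M⁺M allocation always exists for goods.) -/
/-- The total value of the bundle given to agent `j` by allocation/partition `f`. -/
noncomputable def bundleVal {M : Type*} [Fintype M] {n : ℕ} (v : M → ℝ)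
    (f : M → Fin n) (j : Fin n) : ℝ :=
  ∑ e ∈ Finset.univ.filter (fun e => f e = j), v e

/-- The maximin share: max over partitions into `n` bundles of the min bundle value. -/
noncomputable def MMS {M : Type*} [Fintype M] [DecidableEq M] (n : ℕ) [NeZero n]
    (v : M → ℝ) : ℝ :=
  Finset.univ.sup' Finset.univ_nonempty fun f : M → Fin n =>
    Finset.univ.inf' Finset.univ_nonempty fun j => bundleVal v f j

/-- The minimax share: min over partitions into `n` bundles of the max bundle value. -/
noncomputable def mmS {M : Type*} [Fintype M] [DecidableEq M] (n : ℕ) [NeZero n]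
    (v : M → ℝ) : ℝ :=
  Finset.univ.inf' Finset.univ_nonempty fun f : M → Fin n =>
    Finset.univ.sup' Finset.univ_nonempty fun j => bundleVal v f j

/-- The proportional share: total value divided by the number `n` of agents. -/
noncomputable def PS {M : Type*} [Fintype M] (n : ℕ) (v : M → ℝ) : ℝ :=
  (∑ e, v e) / n

/-- No assignment `a` of the nine cells to the agents (`0` being U, `1` being C and `2` being R)
meets the three thresholds `p`, `m` and `9 / 10 * n`. -/
def Blocked (u c r : Fin 3 → Fin 3 → ℝ) (p m n : ℝ) : Prop :=
  ∀ a : Fin 3 → Fin 3 → Fin 3,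
    (∑ i, ∑ j, if a i j = 0 then u i j else 0) < p ∨
    (∑ i, ∑ j, if a i j = 1 then c i j else 0) < m ∨
    (∑ i, ∑ j, if a i j = 2 then r i j else 0) < 9 / 10 * n

set_option maxHeartbeats 1000000 in
/-- If U and R each accept only row `0`, and U and C each accept only column `0`, then some
assignment of the cells meets all thresholds. -/
lemma not_blocked_of_accept_zero {u c r : Fin 3 → Fin 3 → ℝ} {p m n : ℝ}
    (u0 : ∀ i j, 0 ≤ u i j) (c0 : ∀ i j, 0 ≤ c i j) (r0 : ∀ i j, 0 ≤ r i j)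
    (hu : 3 * p ≤ ∑ i, ∑ j, u i j) (hc : ∀ i, m ≤ ∑ j, c i j) (hr : ∀ j, ∑ i, r i j = n)
    (hrow : ∀ k, k ≠ 0 → ∑ j, u k j < p ∧ ∑ j, r k j < 9 / 10 * n)
    (hcol : ∀ k, k ≠ 0 → ∑ i, u i k < p ∧ ∑ i, c i k < m) :
    ¬ Blocked u c r p m n := by
  intro H
  have u11 := u0 1 1
  have u12 := u0 1 2
  have u21 := u0 2 1
  have u22 := u0 2 2
  have c01 := c0 0 1
  have c02 := c0 0 2
  have r20 := r0 2 0
  have r21 := r0 2 1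
  have r22 := r0 2 2
  obtain ⟨hu1, hr1⟩ := hrow 1 (by decide)
  obtain ⟨hu2, hr2⟩ := hrow 2 (by decide)
  obtain ⟨hu1', hc1'⟩ := hcol 1 (by decide)
  obtain ⟨hu2', hc2'⟩ := hcol 2 (by decide)
  have c_row1 := hc 1
  have c_row2 := hc 2
  have r_col0 := hr 0
  have r_col1 := hr 1
  have r_col2 := hr 2
  simp only [Fin.sum_univ_three] at *
  by_cases hS : u 0 0 + u 0 1 + u 1 0 < p
  · have u_00_02 : u 0 0 + u 0 2 < p := by
      rcases H ![![0, 2, 0], ![1, 2, 1], ![1, 2, 1]] with h | h | h <;>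
        simp [Fin.sum_univ_three] at h <;> linarith
    have r_02_12 : r 0 2 + r 1 2 < 9 / 10 * n := by
      rcases H ![![0, 0, 2], ![0, 0, 2], ![1, 1, 1]] with h | h | h <;>
        simp [Fin.sum_univ_three] at h <;> linarith
    have r_01_11 : r 0 1 + r 1 1 < 9 / 10 * n := by
      rcases H ![![0, 2, 0], ![0, 2, 0], ![1, 1, 1]] with h | h | h <;>
        simp [Fin.sum_univ_three] at h <;> linarith
    have r_00_01_10 : r 0 0 + r 0 1 + r 1 0 < 9 / 10 * n := by
      rcases H ![![2, 2, 0], ![2, 0, 0], ![1, 1, 1]] with h | h | h <;>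
        simp [Fin.sum_univ_three] at h <;> linarith
    have u_01_10_12 : u 0 1 + u 1 0 + u 1 2 < p := by
      rcases H ![![2, 0, 2], ![0, 2, 0], ![1, 1, 1]] with h | h | h <;>
        simp [Fin.sum_univ_three] at h <;> linarith
    have r_00_02 : r 0 0 + r 0 2 < 9 / 10 * n := by
      rcases H ![![2, 0, 2], ![0, 0, 0], ![1, 1, 1]] with h | h | h <;>
        simp [Fin.sum_univ_three] at h <;> linarith
    have u_00_10_11 : u 0 0 + u 1 0 + u 1 1 < p := by
      rcases H ![![0, 2, 2], ![0, 0, 2], ![1, 1, 1]] with h | h | h <;>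
        simp [Fin.sum_univ_three] at h <;> linarith
    have r_01_10_12 : r 0 1 + r 1 0 + r 1 2 < 9 / 10 * n := by
      rcases H ![![0, 2, 0], ![2, 0, 2], ![1, 1, 1]] with h | h | h <;>
        simp [Fin.sum_univ_three] at h <;> linarith
    have u_01_20 : u 0 1 + u 2 0 < p := by
      rcases H ![![2, 0, 2], ![1, 1, 1], ![0, 2, 2]] with h | h | h <;>
        simp [Fin.sum_univ_three] at h <;> linarith
    have r_00_02_22 : r 0 0 + r 0 2 + r 2 2 < 9 / 10 * n := by
      rcases H ![![2, 0, 2], ![1, 1, 1], ![0, 0, 2]] with h | h | h <;>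
        simp [Fin.sum_univ_three] at h <;> linarith
    rcases H ![![0, 2, 0], ![1, 1, 1], ![2, 0, 0]] with h | h | h <;>
      simp [Fin.sum_univ_three] at h <;> linarith
  · rw [not_lt] at hS
    have u_00_01 : u 0 0 + u 0 1 < p := by
      rcases H ![![0, 0, 2], ![1, 1, 2], ![1, 1, 2]] with h | h | h <;>
        simp [Fin.sum_univ_three] at h <;> linarith
    have u_00_10 : u 0 0 + u 1 0 < p := by
      rcases H ![![0, 2, 2], ![0, 2, 2], ![1, 1, 1]] with h | h | h <;>
        simp [Fin.sum_univ_three] at h <;> linarith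
    have r_02_11_12 : r 0 2 + r 1 1 + r 1 2 < 9 / 10 * n := by
      rcases H ![![0, 0, 2], ![0, 2, 2], ![1, 1, 1]] with h | h | h <;>
        simp [Fin.sum_univ_three] at h <;> linarith
    have r_01_11 : r 0 1 + r 1 1 < 9 / 10 * n := by
      rcases H ![![0, 2, 0], ![0, 2, 0], ![1, 1, 1]] with h | h | h <;>
        simp [Fin.sum_univ_three] at h <;> linarith
    have r_02_22 : r 0 2 + r 2 2 < 9 / 10 * n := by
      rcases H ![![0, 0, 2], ![1, 1, 1], ![0, 0, 2]] with h | h | h <;>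
        simp [Fin.sum_univ_three] at h <;> linarith
    have r_01_21 : r 0 1 + r 2 1 < 9 / 10 * n := by
      rcases H ![![0, 2, 0], ![1, 1, 1], ![0, 2, 0]] with h | h | h <;>
        simp [Fin.sum_univ_three] at h <;> linarith
    have u_00_02_20 : u 0 0 + u 0 2 + u 2 0 < p := by
      rcases H ![![0, 2, 0], ![1, 1, 1], ![0, 2, 2]] with h | h | h <;>
        simp [Fin.sum_univ_three] at h <;> linarith
    have r_00_10 : r 0 0 + r 1 0 < 9 / 10 * n := by
      rcases H ![![2, 0, 0], ![2, 0, 0], ![1, 1, 1]] with h | h | h <;>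
        simp [Fin.sum_univ_three] at h <;> linarith
    have r_00_01 : r 0 0 + r 0 1 < 9 / 10 * n := by
      rcases H ![![2, 2, 0], ![0, 0, 0], ![1, 1, 1]] with h | h | h <;>
        simp [Fin.sum_univ_three] at h <;> linarith
    have r_00_02_20 : r 0 0 + r 0 2 + r 2 0 < 9 / 10 * n := by
      rcases H ![![2, 0, 2], ![1, 1, 1], ![2, 0, 0]] with h | h | h <;>
        simp [Fin.sum_univ_three] at h <;> linarith
    have u_00_20_21 : u 0 0 + u 2 0 + u 2 1 < p := by
      rcases H ![![0, 2, 2], ![1, 1, 1], ![0, 0, 2]] with h | h | h <;>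
        simp [Fin.sum_univ_three] at h <;> linarith
    have u_02_20_21 : u 0 2 + u 2 0 + u 2 1 < p := by
      rcases H ![![2, 2, 0], ![1, 1, 1], ![0, 0, 2]] with h | h | h <;>
        simp [Fin.sum_univ_three] at h <;> linarith
    have u_00_20_22 : u 0 0 + u 2 0 + u 2 2 < p := by
      rcases H ![![0, 2, 2], ![1, 1, 1], ![0, 2, 0]] with h | h | h <;>
        simp [Fin.sum_univ_three] at h <;> linarith
    have u_01_12 : u 0 1 + u 1 2 < p := by
      rcases H ![![2, 0, 2], ![2, 2, 0], ![1, 1, 1]] with h | h | h <;>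
        simp [Fin.sum_univ_three] at h <;> linarith
    have r_00_02_12 : r 0 0 + r 0 2 + r 1 2 < 9 / 10 * n := by
      rcases H ![![2, 0, 2], ![0, 0, 2], ![1, 1, 1]] with h | h | h <;>
        simp [Fin.sum_univ_three] at h <;> linarith
    have r_01_12 : r 0 1 + r 1 2 < 9 / 10 * n := by
      rcases H ![![0, 2, 0], ![0, 0, 2], ![1, 1, 1]] with h | h | h <;>
        simp [Fin.sum_univ_three] at h <;> linarith
    have r_00_01_11 : r 0 0 + r 0 1 + r 1 1 < 9 / 10 * n := by
      rcases H ![![2, 2, 0], ![0, 2, 0], ![1, 1, 1]] with h | h | h <;>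
        simp [Fin.sum_univ_three] at h <;> linarith
    have r_02_20_21 : r 0 2 + r 2 0 + r 2 1 < 9 / 10 * n := by
      rcases H ![![0, 0, 2], ![1, 1, 1], ![2, 2, 0]] with h | h | h <;>
        simp [Fin.sum_univ_three] at h <;> linarith
    have u_00_01_20 : u 0 0 + u 0 1 + u 2 0 < p := by
      rcases H ![![0, 0, 2], ![1, 1, 1], ![0, 2, 2]] with h | h | h <;>
        simp [Fin.sum_univ_three] at h <;> linarith
    have u_00_20_21_22 : u 0 0 + u 2 0 + u 2 1 + u 2 2 < p := by
      rcases H ![![0, 2, 2], ![1, 1, 1], ![0, 0, 0]] with h | h | h <;>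
        simp [Fin.sum_univ_three] at h <;> linarith
    have u_02_10 : u 0 2 + u 1 0 < p := by
      rcases H ![![2, 2, 0], ![0, 2, 2], ![1, 1, 1]] with h | h | h <;>
        simp [Fin.sum_univ_three] at h <;> linarith
    linarith [hu1, hu1', hu2', u_00_01_20, u_00_20_21_22, u_02_10]

/-- If agents with values `x` and `y` for three bundles never accept two distinct bundles, then
they both accept one and the same bundle only. -/
lemma exists_unique_accepted {x y : Fin 3 → ℝ} {p q : ℝ}
    (hxy : ∀ i j, i ≠ j → x i < p ∨ y j < q) (hx : 3 * p ≤ ∑ i, x i) (hy : 3 * q ≤ ∑ i, y i) :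
    ∃ i, ∀ k, k ≠ i → x k < p ∧ y k < q := by
  obtain ⟨i, hi⟩ : ∃ i, p ≤ x i := by
    by_contra! h
    rw [Fin.sum_univ_three] at hx
    linarith [h 0, h 1, h 2]
  obtain ⟨j, hj⟩ : ∃ j, q ≤ y j := by
    by_contra! h
    rw [Fin.sum_univ_three] at hy
    linarith [h 0, h 1, h 2]
  obtain rfl : i = j := by
    by_contra hij
    rcases hxy i j hij with h | h <;> linarith
  exact ⟨i, fun k hk => ⟨(hxy k i hk).resolve_right hj.not_gt,
    (hxy i k hk.symm).resolve_left hi.not_gt⟩⟩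

lemma Blocked.reindex {u c r : Fin 3 → Fin 3 → ℝ} {p m n : ℝ} (H : Blocked u c r p m n)
    (σ τ : Equiv.Perm (Fin 3)) :
    Blocked (fun i j => u (σ i) (τ j)) (fun i j => c (σ i) (τ j)) (fun i j => r (σ i) (τ j))
      p m n := by
  intro a
  have key (w : Fin 3 → Fin 3 → ℝ) (k : Fin 3) :
      (∑ i, ∑ j, if a i j = k then w (σ i) (τ j) else 0) =
        ∑ i, ∑ j, if a (σ.symm i) (τ.symm j) = k then w i j else 0 := by
    refine Eq.trans (Finset.sum_congr rfl fun i _ => ?_) (Equiv.sum_comp σ _)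
    refine Eq.trans (Finset.sum_congr rfl fun j _ => ?_) (Equiv.sum_comp τ _)
    simp
  simpa only [key] using H fun i j => a (σ.symm i) (τ.symm j)

lemma not_blocked_of_sum_col_eq {u c r : Fin 3 → Fin 3 → ℝ} {p m n : ℝ}
    (u0 : ∀ i j, 0 ≤ u i j) (c0 : ∀ i j, 0 ≤ c i j) (r0 : ∀ i j, 0 ≤ r i j)
    (hu : 3 * p ≤ ∑ i, ∑ j, u i j) (hc : ∀ i, m ≤ ∑ j, c i j) (hr : ∀ j, ∑ i, r i j = n) :
    ¬ Blocked u c r p m n := by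
  intro H
  have hn : 0 ≤ n := hr 0 ▸ Finset.sum_nonneg fun i _ => r0 i 0
  have hr_sum : ∑ i, ∑ j, r i j = 3 * n := by
    rw [Finset.sum_comm]
    simp [hr]
  have hc_sum : 3 * m ≤ ∑ i, ∑ j, c i j := by
    rw [Fin.sum_univ_three]
    linarith [hc 0, hc 1, hc 2]
  obtain ⟨i, hi⟩ : ∃ i, ∀ k, k ≠ i → ∑ j, u k j < p ∧ ∑ j, r k j < 9 / 10 * n := by
    refine exists_unique_accepted (fun i j hij => ?_) hu (by linarith)
    have h := H fun k _ => if k = i then 0 else if k = j then 2 else 1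
    have h0 := hc 0
    have h1 := hc 1
    have h2 := hc 2
    fin_cases i <;> fin_cases j <;>
      first
      | exact absurd rfl hij
      | simp [Fin.sum_univ_three] at h h0 h1 h2 ⊢
        grind
  obtain ⟨j, hj⟩ : ∃ j, ∀ k, k ≠ j → ∑ i, u i k < p ∧ ∑ i, c i k < m := by
    refine exists_unique_accepted (fun i j hij => ?_)
      (hu.trans_eq Finset.sum_comm) (hc_sum.trans_eq Finset.sum_comm)
    have h := H fun _ k => if k = i then 0 else if k = j then 1 else 2
    have h0 := hr 0
    have h1 := hr 1
    have h2 := hr 2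
    fin_cases i <;> fin_cases j <;>
      first
      | exact absurd rfl hij
      | simp [Fin.sum_univ_three] at h h0 h1 h2 ⊢
        grind
  let σ := Equiv.swap 0 i
  let τ := Equiv.swap 0 j
  have hσ {k : Fin 3} (hk : k ≠ 0) : σ k ≠ i := by
    simpa [σ] using σ.injective.ne hk
  have hτ {k : Fin 3} (hk : k ≠ 0) : τ k ≠ j := by
    simpa [τ] using τ.injective.ne hk
  have row (w : Fin 3 → Fin 3 → ℝ) (k : Fin 3) : ∑ l, w k (τ l) = ∑ l, w k l :=
    Equiv.sum_comp τ _
  have col (w : Fin 3 → Fin 3 → ℝ) (k : Fin 3) : ∑ l, w (σ l) k = ∑ l, w l k :=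
    Equiv.sum_comp σ fun l => w l k
  refine not_blocked_of_accept_zero (fun i j => u0 _ _) (fun i j => c0 _ _) (fun i j => r0 _ _)
    ?_ (fun i => ?_) (fun j => ?_) (fun k hk => ?_) (fun k hk => ?_) (H.reindex σ τ)
  · simpa only [row, Equiv.sum_comp σ fun l => ∑ j, u l j] using hu
  · simpa only [row] using hc (σ i)
  · simpa only [col] using hr (τ j)
  · simpa only [row] using hi _ (hσ hk)
  · simpa only [col] using hj _ (hτ hk)

lemma not_blocked {u c r : Fin 3 → Fin 3 → ℝ} {p m n : ℝ}
    (u0 : ∀ i j, 0 ≤ u i j) (c0 : ∀ i j, 0 ≤ c i j) (r0 : ∀ i j, 0 ≤ r i j) (hn : 0 ≤ n)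
    (hu : 3 * p ≤ ∑ i, ∑ j, u i j) (hc : ∀ i, m ≤ ∑ j, c i j) (hr : ∀ j, n ≤ ∑ i, r i j) :
    ¬ Blocked u c r p m n := by
  intro H
  have hs (j : Fin 3) : 0 ≤ n / ∑ i, r i j := div_nonneg hn (hn.trans (hr j))
  have hs1 (j : Fin 3) : n / ∑ i, r i j ≤ 1 := div_le_one_of_le₀ (hr j) (hn.trans (hr j))
  refine not_blocked_of_sum_col_eq (n := n) (r := fun i j => r i j * (n / ∑ i, r i j)) u0 c0
    (fun i j => mul_nonneg (r0 i j) (hs j)) hu hc (fun j => ?_) fun a => ?_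
  · rw [← Finset.sum_mul]
    apply mul_div_cancel_of_imp'
    intro h
    linarith [hr j]
  · refine (H a).imp_right (Or.imp_right (lt_of_le_of_lt ?_))
    gcongr with i _ j _
    split_ifs
    · exact mul_le_of_le_one_right (r0 i j) (hs1 j)
    · exact le_rfl

lemma exists_bundleVal_ge_MMS {M : Type*} [Fintype M] [DecidableEq M] (n : ℕ) [NeZero n]
    (w : M → ℝ) : ∃ f : M → Fin n, ∀ j, MMS n w ≤ bundleVal w f j := by
  obtain ⟨f, -, hf⟩ := Finset.exists_mem_eq_sup' (Finset.univ_nonempty (α := M → Fin n))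
    fun f => Finset.univ.inf' Finset.univ_nonempty fun j => bundleVal w f j
  exact ⟨f, fun j => hf.le.trans (Finset.inf'_le _ (Finset.mem_univ j))⟩

lemma MMS_nonneg {M : Type*} [Fintype M] [DecidableEq M] (n : ℕ) [NeZero n]
    {w : M → ℝ} (hw : ∀ e, 0 ≤ w e) : 0 ≤ MMS n w :=
  Finset.le_sup'_of_le _ (Finset.mem_univ fun _ => 0) <|
    Finset.le_inf' _ _ fun _ _ => Finset.sum_nonneg fun e _ => hw e

/-- The value of the items lying in part `i` of `f` and part `j` of `g`. -/
noncomputable def cellVal {M : Type*} [Fintype M] (w : M → ℝ) (f g : M → Fin 3)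
    (i j : Fin 3) : ℝ :=
  ∑ e with f e = i ∧ g e = j, w e

lemma sum_filter_eq_sum_cellVal {M : Type*} [Fintype M] (w : M → ℝ) (f g : M → Fin 3)
    (P : Fin 3 → Fin 3 → Prop) [∀ i j, Decidable (P i j)] :
    ∑ e with P (f e) (g e), w e = ∑ i, ∑ j, if P i j then cellVal w f g i j else 0 := by
  have h (i j : Fin 3) : (if P i j then cellVal w f g i j else 0) =
      ∑ e, if f e = i then if g e = j then if P i j then w e else 0 else 0 else 0 := by
    simp only [cellVal, Finset.sum_filter, ite_and]
    split_ifs <;> simp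
  simp_rw [h, Finset.sum_filter]
  simp_rw [Finset.sum_comm (s := Finset.univ (α := Fin 3)) (t := Finset.univ (α := M))]
  simp

/-- For three agents with additive nonnegative valuations over goods and
any labeling of the agents as U, C, R, there is an allocation in which U gets her full
proportional share, C gets her full maximin share, and R gets at least 9/10 of her
maximin share (a (9/10)-P⁺M⁺M allocation). -/
theorem exists_P_plus_M_plus_M_allocation_goods {M : Type*} [Fintype M] [DecidableEq M]
    (v : Fin 3 → M → ℝ) (hv : ∀ i e, 0 ≤ v i e) (u c r : Fin 3)
    (huc : u ≠ c) (hur : u ≠ r) (hcr : c ≠ r) :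
    ∃ A : M → Fin 3, PS 3 (v u) ≤ bundleVal (v u) A u ∧
      MMS 3 (v c) ≤ bundleVal (v c) A c ∧
      (9/10 : ℝ) * MMS 3 (v r) ≤ bundleVal (v r) A r := by
  obtain ⟨f, hf⟩ := exists_bundleVal_ge_MMS 3 (v c)
  obtain ⟨g, hg⟩ := exists_bundleVal_ge_MMS 3 (v r)
  have h0 (k i j : Fin 3) : 0 ≤ cellVal (v k) f g i j := Finset.sum_nonneg fun e _ => hv k e
  have hu : 3 * PS 3 (v u) ≤ ∑ i, ∑ j, cellVal (v u) f g i j := by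
    have := sum_filter_eq_sum_cellVal (v u) f g fun _ _ => True
    simp only [Finset.filter_true, if_true] at this
    rw [PS, ← this]
    push_cast
    linarith
  have hc (i : Fin 3) : MMS 3 (v c) ≤ ∑ j, cellVal (v c) f g i j := by
    have := sum_filter_eq_sum_cellVal (v c) f g fun k _ => k = i
    rw [Finset.sum_comm] at this
    simpa [this, bundleVal] using hf i
  have hr (j : Fin 3) : MMS 3 (v r) ≤ ∑ i, cellVal (v r) f g i j := by
    have := sum_filter_eq_sum_cellVal (v r) f g fun _ k => k = j
    simpa [this, bundleVal] using hg j
  have H := not_blocked (h0 u) (h0 c) (h0 r) (MMS_nonneg 3 (hv r)) hu hc hr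
  simp only [Blocked, not_forall, not_or, not_lt] at H
  obtain ⟨a, ha0, ha1, ha2⟩ := H
  let lab : Fin 3 → Fin 3 := ![u, c, r]
  have lab_inj : Function.Injective lab := by
    intro i j
    fin_cases i <;> fin_cases j <;> simp [lab, huc, hur, hcr, huc.symm, hur.symm, hcr.symm]
  have val (k : Fin 3) (w : M → ℝ) : bundleVal w (fun e => lab (a (f e) (g e))) (lab k) =
      ∑ i, ∑ j, if a i j = k then cellVal w f g i j else 0 := by
    simpa only [bundleVal, lab_inj.eq_iff] using sum_filter_eq_sum_cellVal w f g fun i j => a i j = k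
  exact ⟨fun e => lab (a (f e) (g e)), ha0.trans_eq (val 0 _).symm, ha1.trans_eq (val 1 _).symm,
    ha2.trans_eq (val 2 _).symm⟩
end

section
/- Consider nine items arranged in a 3×3 grid with a single additive valuation v whose values are, row by row: (6, 3, 1), (6, 3, 1), (0, 3, 7). Then: (a) the maximin share over partitions of the nine items into three bundles equals 10 (attained by the three rows); and (b) for each j ∈ {2, 3}, every partition of the six items lying outside column j into two bundles has at least one bundle of total v-value at most 9. (This is the instance showing that coarse atomic partial search does not guarantee a ratio better than 9/10.) -/
/-- The single additive valuation on the 3×3 grid of items, row by row: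
(6,3,1), (6,3,1), (0,3,7). -/
noncomputable def gridVal : Fin 3 × Fin 3 → ℝ :=
  fun e => ![![6, 3, 1], ![6, 3, 1], ![0, 3, 7]] e.1 e.2

theorem sum_bundleVal {M : Type*} [Fintype M] {n : ℕ} (v : M → ℝ) (f : M → Fin n) :
    ∑ j, bundleVal v f j = ∑ e, v e :=
  Finset.sum_fiberwise _ f v

/-- The maximin share never exceeds the proportional share. -/
theorem MMS_le_PS {M : Type*} [Fintype M] [DecidableEq M] (n : ℕ) [NeZero n] (v : M → ℝ) :
    MMS n v ≤ PS n v := by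
  refine Finset.sup'_le _ _ fun f _ => ?_
  have hn : (0 : ℝ) < n := Nat.cast_pos.2 (NeZero.pos n)
  rw [PS, le_div_iff₀ hn, ← sum_bundleVal v f, mul_comm]
  simpa using Finset.card_nsmul_le_sum Finset.univ (bundleVal v f) _
    fun j hj => Finset.inf'_le (bundleVal v f) hj

theorem le_MMS {M : Type*} [Fintype M] [DecidableEq M] {n : ℕ} [NeZero n] {v : M → ℝ} {a : ℝ}
    (f : M → Fin n) (hf : ∀ j, a ≤ bundleVal v f j) : a ≤ MMS n v :=
  (Finset.le_inf' _ _ fun j _ => hf j).trans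
    (Finset.le_sup' (fun f : M → Fin n => Finset.univ.inf' Finset.univ_nonempty (bundleVal v f))
      (Finset.mem_univ f))

theorem sum_gridVal (S : Finset (Fin 3 × Fin 3)) :
    ∑ e ∈ S, gridVal e =
      ((if (0, 0) ∈ S then 6 else 0) + (if (0, 1) ∈ S then 3 else 0) +
        (if (0, 2) ∈ S then 1 else 0)) +
      ((if (1, 0) ∈ S then 6 else 0) + (if (1, 1) ∈ S then 3 else 0) +
        (if (1, 2) ∈ S then 1 else 0)) +
      ((if (2, 1) ∈ S then 3 else 0) + (if (2, 2) ∈ S then 7 else 0)) := by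
  rw [← Finset.univ_inter S, ← Finset.sum_ite_mem, Fintype.sum_prod_type]
  simp [Fin.sum_univ_three, gridVal]

theorem PS_gridVal : PS 3 gridVal = 10 := by
  rw [PS, sum_gridVal]
  norm_num

theorem bundleVal_gridVal_fst (i : Fin 3) : bundleVal gridVal Prod.fst i = 10 := by
  rw [bundleVal, sum_gridVal]
  fin_cases i <;> simp <;> norm_num

/-- (a) The maximin share (over partitions into three bundles) of the
grid valuation equals 10; (b) for each column j ∈ {2,3} (indexed here as j ≠ 0), every
partition of the six items outside column j into two bundles has a bundle of total
value at most 9. -/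
theorem grid_negative_example :
    MMS 3 gridVal = 10 ∧
    ∀ j : Fin 3, j ≠ 0 →
      ∀ S : Finset (Fin 3 × Fin 3),
        S ⊆ Finset.univ.filter (fun e => e.2 ≠ j) →
        min (∑ e ∈ S, gridVal e)
          (∑ e ∈ (Finset.univ.filter (fun e => e.2 ≠ j)) \ S, gridVal e) ≤ 9 := by
  refine ⟨le_antisymm ((MMS_le_PS 3 gridVal).trans_eq PS_gridVal)
    (le_MMS Prod.fst fun i => (bundleVal_gridVal_fst i).ge), fun j hj S hS => ?_⟩
  have hcol : ∀ i, (i, j) ∉ S := fun i hi => (Finset.mem_filter.1 (hS hi)).2 rfl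
  rw [sum_gridVal, sum_gridVal, min_le_iff]
  simp only [Finset.mem_sdiff, Finset.mem_filter_univ]
  obtain rfl | rfl : j = 1 ∨ j = 2 := by omega
  all_goals
    simp [hcol]
    grind
end

section
/- Every instance with two agents having additive valuations over a finite set of items admits an MMS allocation: an allocation A = (A_1, A_2) with v^i(A_i) ≥ MMS^i for both agents i (so ρ_2 = 1). -/
theorem bundleVal_perm_comp {M : Type*} [Fintype M] {n : ℕ} (v : M → ℝ) (f : M → Fin n)
    (σ : Equiv.Perm (Fin n)) (j : Fin n) :
    bundleVal v (σ ∘ f) j = bundleVal v f (σ.symm j) := by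
  simp only [bundleVal, Function.comp_apply, Equiv.eq_symm_apply]

theorem exists_forall_MMS_le_bundleVal {M : Type*} [Fintype M] [DecidableEq M] (n : ℕ)
    [NeZero n] (v : M → ℝ) : ∃ f : M → Fin n, ∀ j, MMS n v ≤ bundleVal v f j := by
  obtain ⟨f, -, hf⟩ := Finset.exists_mem_eq_sup' Finset.univ_nonempty
    fun f : M → Fin n => Finset.univ.inf' Finset.univ_nonempty fun j => bundleVal v f j
  exact ⟨f, fun j => hf.trans_le (Finset.inf'_le _ (Finset.mem_univ j))⟩

theorem exists_PS_le_bundleVal {M : Type*} [Fintype M] {n : ℕ} [NeZero n] (v : M → ℝ)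
    (f : M → Fin n) : ∃ j, PS n v ≤ bundleVal v f j := by
  have hn : (n : ℝ) ≠ 0 := NeZero.ne _
  obtain ⟨j, -, hj⟩ := Finset.exists_le_of_sum_le (f := fun _ => PS n v) (g := bundleVal v f)
    Finset.univ_nonempty (by simp [sum_bundleVal, PS, mul_div_cancel₀ _ hn])
  exact ⟨j, hj⟩

/-- Every instance with two agents with additive valuations admits an MMS
allocation. -/
theorem exists_MMS_allocation_two_agents {M : Type*} [Fintype M] [DecidableEq M]
    (v : Fin 2 → M → ℝ) :
    ∃ A : M → Fin 2, ∀ i, MMS 2 (v i) ≤ bundleVal (v i) A i := by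
  obtain ⟨f, hf⟩ := exists_forall_MMS_le_bundleVal 2 (v 0)
  obtain ⟨j, hj⟩ := exists_PS_le_bundleVal (v 1) f
  refine ⟨Equiv.swap j 1 ∘ f, Fin.forall_fin_two.2 ⟨?_, ?_⟩⟩ <;> rw [bundleVal_perm_comp]
  · exact hf _
  · rw [Equiv.symm_swap, Equiv.swap_apply_right]
    exact (MMS_le_PS 2 (v 1)).trans hj
end
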